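/- Let A be an n×n Hermitian matrix over ℂ, let u be an n×n positive semidefinite Hermitian matrix with rank(u) ≤ r, and let ρ : ℝ → ℝ be nondecreasing and continuously differentiable with compactly supported derivative. Define φ(η) := ∑_{i=1}^{n} ρ(λ_i(A + η u)) for η ∈ ℝ. Then for every probability measure μ on ℝ and every δ > 0, ∫ (φ(t+δ) − φ(t)) dμ(t) ≤ s(μ, δ) · r · (sup_{x∈ℝ} ρ(x) − inf_{x∈ℝ} ρ(x)), where s(μ, δ) := sup_{λ∈ℝ} μ([λ−δ, λ+δ]). -/

import Mathlib

open MeasureTheory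
open scoped ComplexOrder

/-- The modulus of continuity `s(μ, ε) = sup_λ μ([λ-ε, λ+ε])` of a measure `μ` on `ℝ`. -/
noncomputable def modulusOfContinuity (μ : Measure ℝ) (ε : ℝ) : ℝ :=
  ⨆ l : ℝ, (μ (Set.Icc (l - ε) (l + ε))).toReal

/-- `A + η • u` is Hermitian for Hermitian `A`, `u` and real `η`. -/
theorem isHermitian_add_real_smul {n : ℕ} {A u : Matrix (Fin n) (Fin n) ℂ}
    (hA : A.IsHermitian) (hu : u.IsHermitian) (η : ℝ) : (A + η • u).IsHermitian :=
  hA.add (IsSelfAdjoint.smul (star_trivial η) hu)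

section
variable {𝕜 E : Type*} [RCLike 𝕜] [NormedAddCommGroup E] [InnerProductSpace 𝕜 E]

theorem LinearMap.IsSymmetric.re_inner_eq_sum_eigenvalues [FiniteDimensional 𝕜 E]
    {T : E →ₗ[𝕜] E} (hT : T.IsSymmetric) {m : ℕ} (hm : Module.finrank 𝕜 E = m) (v : E) :
    RCLike.re (inner 𝕜 (T v) v) =
      ∑ k, hT.eigenvalues hm k * ‖(hT.eigenvectorBasis hm).repr v k‖ ^ 2 := by
  rw [← (hT.eigenvectorBasis hm).sum_inner_mul_inner, map_sum]
  refine Finset.sum_congr rfl fun k _ => ?_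
  rw [hT v, hT.apply_eigenvectorBasis, inner_smul_right, mul_assoc, RCLike.re_ofReal_mul,
    ← inner_conj_symm, RCLike.conj_mul, OrthonormalBasis.repr_apply_apply]
  norm_cast

theorem OrthonormalBasis.repr_eq_zero_of_mem_span {ι : Type*} [Fintype ι]
    (b : OrthonormalBasis ι 𝕜 E) {s : Set ι} {v : E} (hv : v ∈ Submodule.span 𝕜 (b '' s))
    {k : ι} (hk : k ∉ s) : b.repr v k = 0 := by
  rw [← b.coe_toBasis, Module.Basis.mem_span_image] at hv
  by_contra h
  exact hk (hv (by simpa using h))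

theorem OrthonormalBasis.finrank_span_image {ι : Type*} [Fintype ι]
    (b : OrthonormalBasis ι 𝕜 E) (s : Finset ι) :
    Module.finrank 𝕜 (Submodule.span 𝕜 (b '' s)) = s.card := by
  have hli := b.orthonormal.linearIndependent.comp ((↑) : s → ι) Subtype.val_injective
  rw [Set.image_eq_range]
  exact (finrank_span_eq_card hli).trans (Fintype.card_coe s)

/-- **Weyl's inequality**: if the quadratic form of `S` is dominated by that of `T` on a subspace
of codimension at most `r`, then the `(i + r)`-th largest eigenvalue of `S` is at most the `i`-th
largest eigenvalue of `T`. -/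
theorem LinearMap.IsSymmetric.eigenvalues_le_of_forall_mem_re_inner_le
    [FiniteDimensional 𝕜 E] {S T : E →ₗ[𝕜] E}
    (hS : S.IsSymmetric) (hT : T.IsSymmetric) {m r : ℕ} (hm : Module.finrank 𝕜 E = m)
    (W : Submodule 𝕜 E) (hW : m ≤ Module.finrank 𝕜 W + r)
    (h : ∀ v ∈ W, RCLike.re (inner 𝕜 (S v) v) ≤ RCLike.re (inner 𝕜 (T v) v))
    {i j : Fin m} (hij : (j : ℕ) = i + r) : hS.eigenvalues hm j ≤ hT.eigenvalues hm i := by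
  set b := hS.eigenvectorBasis hm with hb
  set c := hT.eigenvectorBasis hm with hc
  set P := Submodule.span 𝕜 (b '' (Finset.Iic j : Finset (Fin m))) with hP
  set Q := Submodule.span 𝕜 (c '' (Finset.Ici i : Finset (Fin m))) with hQ
  have hPdim : Module.finrank 𝕜 P = j + 1 := by
    rw [hP, b.finrank_span_image, Fin.card_Iic]
  have hQdim : Module.finrank 𝕜 Q = m - i := by
    rw [hQ, c.finrank_span_image, Fin.card_Ici]
  obtain ⟨v, hv, hv0⟩ : ∃ v ∈ P ⊓ Q ⊓ W, v ≠ 0 := by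
    rw [← Submodule.ne_bot_iff]
    intro hbot
    have h₁ := Submodule.finrank_sup_add_finrank_inf_eq P Q
    have h₂ := Submodule.finrank_sup_add_finrank_inf_eq (P ⊓ Q) W
    have h₃ := (P ⊔ Q).finrank_le
    have h₄ := (P ⊓ Q ⊔ W).finrank_le
    rw [hbot, finrank_bot] at h₂
    omega
  obtain ⟨⟨hvP, hvQ⟩, hvW⟩ := hv
  have lower : hS.eigenvalues hm j * ‖v‖ ^ 2 ≤ RCLike.re (inner 𝕜 (S v) v) := by
    rw [hS.re_inner_eq_sum_eigenvalues hm, ← b.repr.norm_map, EuclideanSpace.norm_sq_eq,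
      Finset.mul_sum]
    refine Finset.sum_le_sum fun k _ => ?_
    by_cases hk : k ≤ j
    · exact mul_le_mul_of_nonneg_right (hS.eigenvalues_antitone hm hk) (by positivity)
    · rw [← hb, b.repr_eq_zero_of_mem_span hvP (by simpa using hk)]
      simp
  have upper : RCLike.re (inner 𝕜 (T v) v) ≤ hT.eigenvalues hm i * ‖v‖ ^ 2 := by
    rw [hT.re_inner_eq_sum_eigenvalues hm, ← c.repr.norm_map, EuclideanSpace.norm_sq_eq,
      Finset.mul_sum]
    refine Finset.sum_le_sum fun k _ => ?_
    by_cases hk : i ≤ k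
    · exact mul_le_mul_of_nonneg_right (hT.eigenvalues_antitone hm hk) (by positivity)
    · rw [← hc, c.repr_eq_zero_of_mem_span hvQ (by simpa using hk)]
      simp
  exact le_of_mul_le_mul_right ((lower.trans (h v hvW)).trans upper) (by positivity)
end

section
variable {ι : Type*} [Fintype ι] [DecidableEq ι] {A u : Matrix ι ι ℂ}

theorem Matrix.IsHermitian.eigenvalues₀_le_add_posSemidef (hA : A.IsHermitian)
    (hu : u.PosSemidef) (hAu : (A + u).IsHermitian) (i : Fin (Fintype.card ι)) :
    hA.eigenvalues₀ i ≤ hAu.eigenvalues₀ i := by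
  refine LinearMap.IsSymmetric.eigenvalues_le_of_forall_mem_re_inner_le _ _ (r := 0) _ ⊤ ?_
    (fun v _ => ?_) rfl
  · simp
  · have := (Matrix.isPositive_toEuclideanLin_iff.2 hu).re_inner_nonneg_left v
    rw [map_add, LinearMap.add_apply, inner_add_left, map_add]
    linarith

theorem Matrix.IsHermitian.eigenvalues₀_add_le_of_rank_le (hA : A.IsHermitian)
    (hAu : (A + u).IsHermitian) {r : ℕ} (hr : u.rank ≤ r) {i j : Fin (Fintype.card ι)}
    (hij : (j : ℕ) = i + r) : hAu.eigenvalues₀ j ≤ hA.eigenvalues₀ i := by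
  refine LinearMap.IsSymmetric.eigenvalues_le_of_forall_mem_re_inner_le _ _ (r := r) _
    (LinearMap.ker (Matrix.toEuclideanLin u)) ?_ (fun v hv => ?_) hij
  · have h₁ := (Matrix.toEuclideanLin u).finrank_range_add_finrank_ker
    have h₂ : u.rank = Module.finrank ℂ (LinearMap.range (Matrix.toEuclideanLin u)) := by
      rw [Matrix.toEuclideanLin_eq_toLin_orthonormal]
      exact u.rank_eq_finrank_range_toLin _ _
    rw [finrank_euclideanSpace] at h₁
    omega
  · rw [map_add, LinearMap.add_apply, LinearMap.mem_ker.1 hv, add_zero]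
end

theorem sum_sub_sum_le_of_shift_le {m r : ℕ} {a b : Fin m → ℝ} {ρ : ℝ → ℝ} (hmono : Monotone ρ)
    (hab : BddAbove (Set.range ρ)) (hbe : BddBelow (Set.range ρ))
    (h : ∀ i j : Fin m, (j : ℕ) = i + r → b j ≤ a i) :
    ∑ i, ρ (b i) - ∑ i, ρ (a i) ≤ r * ((⨆ x, ρ x) - ⨅ x, ρ x) := by
  set I := ⨅ x, ρ x
  set S := ⨆ x, ρ x
  have hI : ∀ x, I ≤ ρ x := ciInf_le hbe
  have hS : ∀ x, ρ x ≤ S := le_ciSup hab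
  let pad (f : Fin m → ℝ) (k : ℕ) : ℝ := if hk : k < m then ρ (f ⟨k, hk⟩) - I else 0
  have pad_nonneg (f : Fin m → ℝ) (k : ℕ) : 0 ≤ pad f k := by
    simp only [pad]; split_ifs
    · linarith [hI (f ⟨k, ‹_›⟩)]
    · rfl
  have pad_le (f : Fin m → ℝ) (k : ℕ) : pad f k ≤ S - I := by
    simp only [pad]; split_ifs
    · linarith [hS (f ⟨k, ‹_›⟩)]
    · linarith [hI 0, hS 0]
  have pad_sum (f : Fin m → ℝ) : ∑ k ∈ Finset.range m, pad f k = ∑ i, ρ (f i) - m * I := by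
    rw [← Fin.sum_univ_eq_sum_range]
    simp [pad]
  have shift (k : ℕ) : pad b (r + k) ≤ pad a k := by
    by_cases hk : r + k < m
    · have hk' : k < m := by omega
      simp only [pad, hk, hk', dif_pos]
      linarith [hmono (h ⟨k, hk'⟩ ⟨r + k, hk⟩ (add_comm _ _))]
    · simpa only [pad, hk, dif_neg, not_false_iff] using pad_nonneg a k
  have key : ∑ k ∈ Finset.range m, pad b k ≤ r * (S - I) + ∑ k ∈ Finset.range m, pad a k :=
    calc ∑ k ∈ Finset.range m, pad b k
        ≤ ∑ k ∈ Finset.range (r + m), pad b k :=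
          Finset.sum_le_sum_of_subset_of_nonneg (Finset.range_mono (Nat.le_add_left _ _))
            fun k _ _ => pad_nonneg b k
      _ = ∑ k ∈ Finset.range r, pad b k + ∑ k ∈ Finset.range m, pad b (r + k) :=
          Finset.sum_range_add ..
      _ ≤ r * (S - I) + ∑ k ∈ Finset.range m, pad a k := by
          gcongr with k
          · simpa using Finset.sum_le_card_nsmul (Finset.range r) (pad b) (S - I)
              fun k _ => pad_le b k
          · exact shift k
  rw [pad_sum, pad_sum] at key
  linarith

theorem isBounded_range_of_hasCompactSupport_deriv {ρ : ℝ → ℝ} (hρ : ContDiff ℝ 1 ρ)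
    (hsupp : HasCompactSupport (deriv ρ)) : Bornology.IsBounded (Set.range ρ) := by
  have hcont : Continuous (deriv ρ) := hρ.continuous_deriv le_rfl
  have hint : Integrable (deriv ρ) := hcont.integrable_of_hasCompactSupport hsupp
  refine (Metric.isBounded_closedBall (x := ρ 0) (r := ∫ x, ‖deriv ρ x‖)).subset ?_
  rintro _ ⟨x, rfl⟩
  rw [mem_closedBall_iff_norm, ← intervalIntegral.integral_deriv_eq_sub
    (fun y _ => (hρ.differentiable one_ne_zero).differentiableAt) (hcont.intervalIntegrable _ _)]
  exact intervalIntegral.norm_integral_le_integral_norm_uIoc.trans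
    (setIntegral_le_integral hint.norm (Filter.Eventually.of_forall fun _ => norm_nonneg _))

theorem measure_Icc_le_modulusOfContinuity (μ : Measure ℝ) [IsProbabilityMeasure μ] (ε l : ℝ) :
    μ (Set.Icc (l - ε) (l + ε)) ≤ ENNReal.ofReal (modulusOfContinuity μ ε) := by
  rw [← ENNReal.ofReal_toReal (measure_ne_top μ (Set.Icc (l - ε) (l + ε)))]
  refine ENNReal.ofReal_le_ofReal (le_ciSup (f := fun l => (μ (Set.Icc (l - ε) (l + ε))).toReal)
    ⟨1, ?_⟩ l)
  rintro _ ⟨x, rfl⟩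
  exact measureReal_le_one

theorem modulusOfContinuity_nonneg (μ : Measure ℝ) (ε : ℝ) : 0 ≤ modulusOfContinuity μ ε :=
  Real.iSup_nonneg fun _ => ENNReal.toReal_nonneg

theorem StieltjesFunction.measure_univ_le_ofReal (f : StieltjesFunction ℝ) {V : ℝ}
    (hV : ∀ a b, f b - f a ≤ V) : f.measure Set.univ ≤ ENNReal.ofReal V := by
  have hbe : BddBelow (Set.range f) := ⟨f 0 - V, by rintro _ ⟨x, rfl⟩; linarith [hV x 0]⟩
  have hab : BddAbove (Set.range f) := ⟨f 0 + V, by rintro _ ⟨x, rfl⟩; linarith [hV 0 x]⟩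
  rw [f.measure_univ (tendsto_atBot_ciInf f.mono hbe) (tendsto_atTop_ciSup f.mono hab)]
  refine ENNReal.ofReal_le_ofReal (sub_le_iff_le_add'.2 (ciSup_le fun b => ?_))
  linarith [le_ciInf fun a => sub_le_comm.1 (hV a b)]

/-- Averaging the increments over steps of length `δ` of a monotone function with oscillation at
most `V` against `μ` gives at most `s(μ, δ) * V`, by Tonelli for `μ` and the Stieltjes measure. -/
theorem Monotone.integral_sub_le_modulusOfContinuity_mul {φ : ℝ → ℝ} (hφ : Monotone φ) {V : ℝ}
    (hV : ∀ a b, φ b - φ a ≤ V) (μ : Measure ℝ) [IsProbabilityMeasure μ] {δ : ℝ} (hδ : 0 ≤ δ) :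
    ∫ t, (φ (t + δ) - φ t) ∂μ ≤ modulusOfContinuity μ δ * V := by
  have hs := modulusOfContinuity_nonneg μ δ
  have hV0 : 0 ≤ V := by simpa using hV 0 0
  set ν := hφ.stieltjesFunction.measure
  have hν : ν Set.univ ≤ ENNReal.ofReal V := by
    refine StieltjesFunction.measure_univ_le_ofReal _ fun a b => ?_
    rw [hφ.stieltjesFunction_eq, hφ.stieltjesFunction_eq]
    linarith [hV a (b + 1), hφ.rightLim_le (lt_add_one b), hφ.le_rightLim (le_refl a)]
  have hincr (t : ℝ) : ENNReal.ofReal (φ (t + δ) - φ t) ≤ ν (Set.Icc t (t + δ)) := by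
    rw [StieltjesFunction.measure_Icc]
    refine ENNReal.ofReal_le_ofReal (sub_le_sub (hφ.le_rightLim le_rfl) ?_)
    refine _root_.le_of_tendsto (hφ.stieltjesFunction.mono.tendsto_leftLim t) ?_
    filter_upwards [self_mem_nhdsWithin] with s hs using hφ.rightLim_le hs
  let D : Set (ℝ × ℝ) := {p | p.1 ≤ p.2 ∧ p.2 ≤ p.1 + δ}
  have hD : MeasurableSet D :=
    (measurableSet_le measurable_fst measurable_snd).inter
      (measurableSet_le measurable_snd (measurable_fst.add_const δ))
  rw [integral_eq_lintegral_of_nonneg_ae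
    (Filter.Eventually.of_forall fun t => sub_nonneg.2 (hφ (le_add_of_nonneg_right hδ)))
    ((hφ.measurable.comp (measurable_add_const δ)).sub hφ.measurable).aestronglyMeasurable]
  refine ENNReal.toReal_le_of_le_ofReal (mul_nonneg hs hV0) ?_
  calc ∫⁻ t, ENNReal.ofReal (φ (t + δ) - φ t) ∂μ
      ≤ ∫⁻ t, ν (Prod.mk t ⁻¹' D) ∂μ := lintegral_mono hincr
    _ = ∫⁻ x, μ ((fun t => (t, x)) ⁻¹' D) ∂ν := by
        rw [← Measure.prod_apply hD, Measure.prod_apply_symm hD]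
    _ ≤ ∫⁻ _, ENNReal.ofReal (modulusOfContinuity μ δ) ∂ν := by
        refine lintegral_mono fun x => (measure_mono ?_).trans
          (measure_Icc_le_modulusOfContinuity μ δ x)
        rintro t ⟨h₁, h₂⟩
        constructor <;> linarith
    _ ≤ ENNReal.ofReal (modulusOfContinuity μ δ * V) := by
        rw [lintegral_const, ENNReal.ofReal_mul hs]
        gcongr

theorem Matrix.rank_real_smul_le {ι : Type*} [Fintype ι] [DecidableEq ι] (c : ℝ)
    (u : Matrix ι ι ℂ) : (c • u).rank ≤ u.rank := by
  have h : c • u = u * c • (1 : Matrix ι ι ℂ) := by rw [Matrix.mul_smul, Matrix.mul_one]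
  exact h ▸ Matrix.rank_mul_le_left u _

theorem Matrix.IsHermitian.sum_eigenvalues_eq_sum_eigenvalues₀ {ι : Type*} [Fintype ι]
    [DecidableEq ι] {A : Matrix ι ι ℂ} (hA : A.IsHermitian) (f : ℝ → ℝ) :
    ∑ i, f (hA.eigenvalues i) = ∑ k, f (hA.eigenvalues₀ k) :=
  Equiv.sum_comp _ fun k => f (hA.eigenvalues₀ k)

/-- Single-coupling spectral averaging: for `φ(η) = Tr ρ(A + η u)` with `u ⪰ 0` of rank at
most `r` and `ρ` a nondecreasing `C¹` function with compactly supported derivative, the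
averaged increment `∫ (φ(t+δ) - φ(t)) dμ(t)` is bounded by
`s(μ, δ) · r · (sup ρ - inf ρ)` for any probability measure `μ` and `δ > 0`. -/
theorem single_site_spectral_averaging {n : ℕ} (A u : Matrix (Fin n) (Fin n) ℂ)
    (hA : A.IsHermitian) (hu : u.PosSemidef) (r : ℕ) (hrank : u.rank ≤ r)
    (ρ : ℝ → ℝ) (hmono : Monotone ρ) (hρ : ContDiff ℝ 1 ρ)
    (hsupp : HasCompactSupport (deriv ρ))
    (μ : Measure ℝ) [IsProbabilityMeasure μ] (δ : ℝ) (hδ : 0 < δ) :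
    ∫ t, ((∑ i, ρ ((isHermitian_add_real_smul hA hu.isHermitian (t + δ)).eigenvalues i)) -
          (∑ i, ρ ((isHermitian_add_real_smul hA hu.isHermitian t).eigenvalues i))) ∂μ ≤
      modulusOfContinuity μ δ * r * ((⨆ x : ℝ, ρ x) - ⨅ x : ℝ, ρ x) := by
  have hbdd := isBounded_range_of_hasCompactSupport_deriv hρ hsupp
  have hab := hbdd.bddAbove
  have hbe := hbdd.bddBelow
  simp only [Matrix.IsHermitian.sum_eigenvalues_eq_sum_eigenvalues₀]
  set H := isHermitian_add_real_smul hA hu.isHermitian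
  have hsplit {a b : ℝ} : A + b • u = (A + a • u) + (b - a) • u := by module
  have hφ : Monotone fun t => ∑ k, ρ ((H t).eigenvalues₀ k) := by
    refine fun a b hle => Finset.sum_le_sum fun k _ => hmono ?_
    have hHb := H b
    simp only [hsplit (a := a) (b := b)]
    exact (H a).eigenvalues₀_le_add_posSemidef (hu.smul (sub_nonneg.2 hle)) _ k
  rw [mul_assoc]
  refine hφ.integral_sub_le_modulusOfContinuity_mul (fun a b => ?_) μ hδ.le
  refine sum_sub_sum_le_of_shift_le hmono hab hbe fun i j hij => ?_
  simp only [hsplit (a := a) (b := b)]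
  exact (H a).eigenvalues₀_add_le_of_rank_le _ ((Matrix.rank_real_smul_le _ _).trans hrank) hij
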